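/- A subset of X is meager in the topology τ (i.e., a countable union of sets whose τ-closure has empty τ-interior) if and only if it belongs to I. -/

import Mathlib

open Set TopologicalSpace

/-- `I` is a σ-ideal of subsets of `X`: it contains `∅`, is closed under taking
subsets and under countable unions. -/
def IsSigmaIdeal {X : Type*} (I : Set (Set X)) : Prop :=
  ∅ ∈ I ∧ (∀ S T : Set X, S ⊆ T → T ∈ I → S ∈ I) ∧
    ∀ f : ℕ → Set X, (∀ n, f n ∈ I) → (⋃ n, f n) ∈ I

/-- The set `B_s` associated to the pattern with (finite) domain `D` and values `s`:
`B_s = ⋂_{α ∈ D} A_α^{s α}` where `A^1 = A` and `A^0 = X \ A`. -/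
def patternSet {X J : Type*} (A : J → Set X) (D : Finset J) (s : J → Bool) : Set X :=
  ⋂ α ∈ D, if s α then A α else (A α)ᶜ

/-- Two patterns are contradictory if they disagree at some common point of their domains. -/
def Contradictory {J : Type*} (p q : Finset J × (J → Bool)) : Prop :=
  ∃ α, α ∈ p.1 ∧ α ∈ q.1 ∧ p.2 α ≠ q.2 α

/-- Independence mod `I`: `B_s ∉ I` for every pattern `s`. -/
def IndependentModI {X J : Type*} (I : Set (Set X)) (A : J → Set X) : Prop :=
  ∀ (D : Finset J) (s : J → Bool), patternSet A D s ∉ I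

/-- Decomposition: every `S ⊆ X` agrees mod `I` with a countable union of `B_s`'s for
pairwise contradictory patterns. -/
def Decomposition {X J : Type*} (I : Set (Set X)) (A : J → Set X) : Prop :=
  ∀ S : Set X, ∃ P : Set (Finset J × (J → Bool)), P.Countable ∧
    P.Pairwise Contradictory ∧ symmDiff S (⋃ p ∈ P, patternSet A p.1 p.2) ∈ I

/-- Separation: disjoint members of `I` are separated by some `A_α`. -/
def SeparatesIdeal {X J : Type*} (I : Set (Set X)) (A : J → Set X) : Prop :=
  ∀ Z ∈ I, ∀ Z' ∈ I, Disjoint Z Z' → ∃ α, Z ⊆ A α ∧ Z' ⊆ (A α)ᶜ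

/-- The topology `τ` generated by the subbasis
`{A_α \ Z : α ∈ J, Z ∈ I} ∪ {(X \ A_α) \ Z : α ∈ J, Z ∈ I}`. -/
def idealTopology {X J : Type*} (I : Set (Set X)) (A : J → Set X) : TopologicalSpace X :=
  TopologicalSpace.generateFrom
    ({U | ∃ α, ∃ Z ∈ I, U = A α \ Z} ∪ {U | ∃ α, ∃ Z ∈ I, U = (A α)ᶜ \ Z})

section

open scoped Topology

variable {X J : Type*} {I : Set (Set X)} {A : J → Set X}

theorem IsSigmaIdeal.union_mem (hI : IsSigmaIdeal I) {S T : Set X} (hS : S ∈ I) (hT : T ∈ I) :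
    S ∪ T ∈ I := by
  have h := hI.2.2 (fun n => if n = 0 then S else T) (fun n => by split_ifs <;> assumption)
  refine hI.2.1 _ _ ?_ h
  rintro x (hx | hx)
  · exact mem_iUnion.2 ⟨0, by simpa using hx⟩
  · exact mem_iUnion.2 ⟨1, by simpa using hx⟩

theorem IsSigmaIdeal.sUnion_mem (hI : IsSigmaIdeal I) {C : Set (Set X)} (hC : C.Countable)
    (h : ∀ T ∈ C, T ∈ I) : ⋃₀ C ∈ I := by
  rcases C.eq_empty_or_nonempty with rfl | hne
  · simpa using hI.1
  · obtain ⟨f, rfl⟩ := hC.exists_eq_range hne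
    rw [sUnion_range]
    exact hI.2.2 f fun n => h _ (mem_range_self n)

theorem patternSet_diff_notMem (hI : IsSigmaIdeal I) (hind : IndependentModI I A)
    (D : Finset J) (s : J → Bool) {Z : Set X} (hZ : Z ∈ I) : patternSet A D s \ Z ∉ I := by
  intro h
  refine hind D s (hI.2.1 _ _ ?_ (hI.union_mem h hZ))
  rw [sdiff_union_self]
  exact subset_union_left

open Classical in
/-- Around each of its points, a `τ`-open set contains a set `B_s \ Z` with `Z ∈ I`. -/
theorem exists_patternSet_diff_subset (hI : IsSigmaIdeal I) {U : Set X}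
    (hU : IsOpen[idealTopology I A] U) {x : X} (hx : x ∈ U) :
    ∃ D : Finset J, ∃ Z ∈ I, patternSet A D (fun α => decide (x ∈ A α)) \ Z ⊆ U := by
  induction hU with
  | basic V hV =>
    rcases hV with ⟨α, Z, hZ, rfl⟩ | ⟨α, Z, hZ, rfl⟩
    · exact ⟨{α}, Z, hZ, by simp [patternSet, hx.1]⟩
    · have hxA : x ∉ A α := hx.1
      exact ⟨{α}, Z, hZ, by simp [patternSet, hxA]⟩
  | univ => exact ⟨∅, ∅, hI.1, subset_univ _⟩
  | inter V W _ _ ihV ihW =>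
    obtain ⟨D, Z, hZ, hD⟩ := ihV hx.1
    obtain ⟨E, Y, hY, hE⟩ := ihW hx.2
    refine ⟨D ∪ E, Z ∪ Y, hI.union_mem hZ hY, fun y hy => ⟨hD ⟨?_, fun h => hy.2 (.inl h)⟩,
      hE ⟨?_, fun h => hy.2 (.inr h)⟩⟩⟩
    · exact biInter_subset_biInter_left (fun α hα => Finset.mem_union_left E hα) hy.1
    · exact biInter_subset_biInter_left (fun α hα => Finset.mem_union_right D hα) hy.1
  | sUnion C _ ih =>
    obtain ⟨V, hV, hxV⟩ := hx
    obtain ⟨D, Z, hZ, hD⟩ := ih V hV hxV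
    exact ⟨D, Z, hZ, hD.trans (subset_sUnion_of_mem hV)⟩

theorem notMem_of_isOpen (hI : IsSigmaIdeal I) (hind : IndependentModI I A) {U : Set X}
    (hU : IsOpen[idealTopology I A] U) (hne : U.Nonempty) : U ∉ I := by
  obtain ⟨x, hx⟩ := hne
  obtain ⟨D, Z, hZ, hD⟩ := exists_patternSet_diff_subset hI hU hx
  exact fun h => patternSet_diff_notMem hI hind D _ hZ (hI.2.1 _ _ hD h)

theorem isOpen_compl_of_mem [Nonempty J] {Z : Set X} (hZ : Z ∈ I) :
    IsOpen[idealTopology I A] Zᶜ := by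
  let α := Classical.arbitrary J
  let _ := idealTopology I A
  have h₁ : IsOpen (A α \ Z) := isOpen_generateFrom_of_mem (.inl ⟨α, Z, hZ, rfl⟩)
  have h₂ : IsOpen ((A α)ᶜ \ Z) := isOpen_generateFrom_of_mem (.inr ⟨α, Z, hZ, rfl⟩)
  have h := h₁.union h₂
  rwa [← union_sdiff_distrib, union_compl_self, ← compl_eq_univ_sdiff] at h

theorem isOpen_patternSet_diff [Nonempty J] (hI : IsSigmaIdeal I) (D : Finset J) (s : J → Bool)
    {Z : Set X} (hZ : Z ∈ I) : IsOpen[idealTopology I A] (patternSet A D s \ Z) := by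
  let _ := idealTopology I A
  refine IsOpen.inter (isOpen_biInter_finset fun α _ => ?_) (isOpen_compl_of_mem hZ)
  split_ifs
  · exact isOpen_generateFrom_of_mem (.inl ⟨α, ∅, hI.1, by simp⟩)
  · exact isOpen_generateFrom_of_mem (.inr ⟨α, ∅, hI.1, by simp⟩)

theorem isNowhereDense_of_mem [Nonempty J] (hI : IsSigmaIdeal I) (hind : IndependentModI I A)
    {Z : Set X} (hZ : Z ∈ I) : @IsNowhereDense X (idealTopology I A) Z := by
  let _ := idealTopology I A
  have hcl : IsClosed Z := ⟨isOpen_compl_of_mem hZ⟩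
  rw [hcl.isNowhereDense_iff]
  by_contra hne
  exact notMem_of_isOpen hI hind isOpen_interior (nonempty_iff_ne_empty.2 hne)
    (hI.2.1 _ _ interior_subset hZ)

theorem mem_of_isNowhereDense [Nonempty J] (hI : IsSigmaIdeal I) (hind : IndependentModI I A)
    (hdec : Decomposition I A) {S : Set X} (hS : @IsNowhereDense X (idealTopology I A) S) :
    S ∈ I := by
  let _ := idealTopology I A
  obtain ⟨P, -, -, hP⟩ := hdec S
  rcases P.eq_empty_or_nonempty with rfl | ⟨p, hp⟩
  · simpa [symmDiff_def] using hP
  have hZ : patternSet A p.1 p.2 \ S ∈ I := by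
    refine hI.2.1 _ _ ?_ hP
    exact fun x hx => .inr ⟨mem_biUnion hp hx.1, hx.2⟩
  have hsub : patternSet A p.1 p.2 \ (patternSet A p.1 p.2 \ S) ⊆ interior (closure S) := by
    refine interior_maximal ?_ (isOpen_patternSet_diff hI _ _ hZ)
    rw [sdiff_sdiff_right_self]
    exact inter_subset_right.trans subset_closure
  rw [show interior (closure S) = ∅ from hS, subset_empty_iff] at hsub
  exact absurd (hsub ▸ hI.1) (patternSet_diff_notMem hI hind _ _ hZ)

end

theorem stmt_5 {X J : Type*} (I : Set (Set X)) (A : J → Set X)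
    (hI : IsSigmaIdeal I) (hX : (Set.univ : Set X) ∉ I) (hsing : ∀ x : X, ({x} : Set X) ∈ I)
    (hind : IndependentModI I A) (hdec : Decomposition I A) (hsep : SeparatesIdeal I A)
    : ∀ S : Set X, @IsMeagre X (idealTopology I A) S ↔ S ∈ I := by
  obtain ⟨α, -⟩ := hsep ∅ hI.1 ∅ hI.1 (disjoint_empty ∅)
  have : Nonempty J := ⟨α⟩
  let _ := idealTopology I A
  refine fun S => ⟨fun hS => ?_, fun hS => (isNowhereDense_of_mem hI hind hS).isMeagre⟩
  obtain ⟨C, hC, hcount, hsub⟩ := isMeagre_iff_countable_union_isNowhereDense.1 hS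
  exact hI.2.1 _ _ hsub
    (hI.sUnion_mem hcount fun T hT => mem_of_isNowhereDense hI hind hdec (hC T hT))
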